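/- Under hypotheses (H0)-(H4), for every a ∈ D and every z ∈ ℤ^{d−1}×ℕ: Σ_{w∈ℤ^{d−1}×{0}} G(z,w)·exp(a·w) = (1−φ₀(ā))^{−1}·exp(ā·z) if φ₀(ā) < 1, and the sum equals +∞ if φ₀(ā) ≥ 1. -/

import Mathlib

open scoped ENNReal
open Filter MeasureTheory

namespace ReflectedRW

/-- `ℤ^d` realized as `ℤ^{d-1} × ℤ`. -/
abbrev Zd (d : ℕ) := (Fin (d-1) → ℤ) × ℤ
/-- `ℝ^d` realized as `ℝ^{d-1} × ℝ`. -/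
abbrev Rd (d : ℕ) := (Fin (d-1) → ℝ) × ℝ
/-- The state space `ℤ^{d-1} × ℕ` of the reflected walk. -/
abbrev St (d : ℕ) := (Fin (d-1) → ℤ) × ℕ

/-- Embedding of the state space into `ℤ^d`. -/
def toZ (d : ℕ) (z : St d) : Zd d := (z.1, (z.2 : ℤ))

/-- Embedding of `ℤ^d` into `ℝ^d`. -/
def toR (d : ℕ) (z : Zd d) : Rd d := (fun i => (z.1 i : ℝ), (z.2 : ℝ))

/-- Scalar product `a · z` of `a ∈ ℝ^d` and `z ∈ ℤ^d`. -/
noncomputable def dotZ (d : ℕ) (a : Rd d) (z : Zd d) : ℝ :=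
  (∑ i, a.1 i * (z.1 i : ℝ)) + a.2 * (z.2 : ℝ)

/-- Scalar product on `ℝ^d`. -/
noncomputable def dotR (d : ℕ) (a q : Rd d) : ℝ :=
  (∑ i, a.1 i * q.1 i) + a.2 * q.2

/-- One-step transition probabilities of the reflected random walk `Z(t)`:
jumps with law `μ` in the interior and with law `μ0` on the boundary `y = 0`. -/
noncomputable def step (d : ℕ) (μ μ0 : Zd d → ℝ) (z z' : St d) : ℝ≥0∞ :=
  if z.2 = 0 then ENNReal.ofReal (μ0 (toZ d z' - toZ d z))
  else ENNReal.ofReal (μ (toZ d z' - toZ d z))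

/-- Real-valued version of the transition kernel of `Z(t)`. -/
noncomputable def stepR (d : ℕ) (μ μ0 : Zd d → ℝ) (z z' : St d) : ℝ :=
  if z.2 = 0 then μ0 (toZ d z' - toZ d z) else μ (toZ d z' - toZ d z)

/-- `n`-step kernel obtained by iterating a sub-Markov kernel `p`. -/
noncomputable def kerIter {S : Type*} [DecidableEq S] (p : S → S → ℝ≥0∞) :
    ℕ → S → S → ℝ≥0∞
  | 0, z, z' => if z = z' then 1 else 0
  | n+1, z, z' => ∑' w : S, kerIter p n z w * p w z'

/-- `n`-step transition probabilities of `Z(t)`: `P_z(Z(n) = z')`. -/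
noncomputable def stepn (d : ℕ) (μ μ0 : Zd d → ℝ) : ℕ → St d → St d → ℝ≥0∞ :=
  kerIter (step d μ μ0)

/-- Green's function `G(z,z') = ∑_{t ≥ 0} P_z(Z(t) = z')` of the reflected walk. -/
noncomputable def green (d : ℕ) (μ μ0 : Zd d → ℝ) (z z' : St d) : ℝ≥0∞ :=
  ∑' n : ℕ, stepn d μ μ0 n z z'

/-- Kernel of the walk killed upon hitting the boundary hyperplane `y = 0`. -/
noncomputable def stepKilled (d : ℕ) (μ μ0 : Zd d → ℝ) (z z' : St d) : ℝ≥0∞ :=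
  if z'.2 = 0 then 0 else step d μ μ0 z z'

/-- `n`-step kernel of the killed walk: `P_z(Z(n) = z', τ > n)` where
`τ` is the first return time to the boundary hyperplane. -/
noncomputable def stepKilledn (d : ℕ) (μ μ0 : Zd d → ℝ) : ℕ → St d → St d → ℝ≥0∞ :=
  kerIter (stepKilled d μ μ0)

/-- Green's function `G₊(z,z')` of the killed walk. -/
noncomputable def greenPlus (d : ℕ) (μ μ0 : Zd d → ℝ) (z z' : St d) : ℝ≥0∞ :=
  ∑' n : ℕ, stepKilledn d μ μ0 n z z'

/-- One-step kernel of the homogeneous random walk `S(t)` on `ℤ^d`. -/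
noncomputable def stepS (d : ℕ) (μ : Zd d → ℝ) (z z' : Zd d) : ℝ≥0∞ :=
  ENNReal.ofReal (μ (z' - z))

/-- `n`-step kernel of the homogeneous random walk on `ℤ^d`. -/
noncomputable def stepSn (d : ℕ) (μ : Zd d → ℝ) : ℕ → Zd d → Zd d → ℝ≥0∞ :=
  kerIter (stepS d μ)

/-- Green's function `G_S` of the homogeneous random walk on `ℤ^d`. -/
noncomputable def greenS (d : ℕ) (μ : Zd d → ℝ) (z z' : Zd d) : ℝ≥0∞ :=
  ∑' n : ℕ, stepSn d μ n z z'

/-- `hitProb z w = P_z(τ < ∞, Z(τ) = w)`, the hitting distribution on the boundary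
hyperplane, `τ = inf{t ≥ 1 : Z(t) ∈ ℤ^{d-1}×{0}}`. -/
noncomputable def hitProb (d : ℕ) (μ μ0 : Zd d → ℝ) (z w : St d) : ℝ≥0∞ :=
  if w.2 = 0 then
    ∑' n : ℕ, ∑' v : St d, stepKilledn d μ μ0 n z v * step d μ μ0 v w
  else 0

/-- The jump generating function `φ(a) = ∑_z μ(z) e^{a·z}`. -/
noncomputable def jgf (d : ℕ) (μ : Zd d → ℝ) (a : Rd d) : ℝ :=
  ∑' z : Zd d, μ z * Real.exp (dotZ d a z)

/-- Partial derivative `∂φ/∂β` of the jump generating function in the last coordinate. -/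
noncomputable def jgfDβ (d : ℕ) (μ : Zd d → ℝ) (a : Rd d) : ℝ :=
  ∑' z : Zd d, μ z * (z.2 : ℝ) * Real.exp (dotZ d a z)

/-- Gradient `∇φ(a)` of the jump generating function. -/
noncomputable def jgfGrad (d : ℕ) (μ : Zd d → ℝ) (a : Rd d) : Rd d :=
  (fun i => ∑' z : Zd d, μ z * (z.1 i : ℝ) * Real.exp (dotZ d a z), jgfDβ d μ a)

/-- The set `D = {a : φ(a) ≤ 1}`. -/
def Dset (d : ℕ) (μ : Zd d → ℝ) : Set (Rd d) := {a | jgf d μ a ≤ 1}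

/-- `∂₊D`: points of the boundary of `D` where the last coordinate of `∇φ` is `≥ 0`. -/
def bdPlus (d : ℕ) (μ : Zd d → ℝ) : Set (Rd d) :=
  {a | jgf d μ a = 1 ∧ 0 ≤ jgfDβ d μ a}

/-- `∂₋D`: points of the boundary of `D` where the last coordinate of `∇φ` is `≤ 0`. -/
def bdMinus (d : ℕ) (μ : Zd d → ℝ) : Set (Rd d) :=
  {a | jgf d μ a = 1 ∧ jgfDβ d μ a ≤ 0}

/-- `∂₀D`: points of the boundary of `D` where the last coordinate of `∇φ` is `0`. -/
def bdZero (d : ℕ) (μ : Zd d → ℝ) : Set (Rd d) :=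
  {a | jgf d μ a = 1 ∧ jgfDβ d μ a = 0}

/-- `Θ = {α ∈ ℝ^{d-1} : inf_β max(φ(α,β), φ₀(α,β)) ≤ 1}`. -/
noncomputable def Theta (d : ℕ) (μ μ0 : Zd d → ℝ) : Set (Fin (d-1) → ℝ) :=
  {α | (⨅ β : ℝ, max (jgf d μ (α, β)) (jgf d μ0 (α, β))) ≤ 1}

/-- `D̂ = (Θ×ℝ) ∩ D`. -/
noncomputable def Dhat (d : ℕ) (μ μ0 : Zd d → ℝ) : Set (Rd d) :=
  {a | a.1 ∈ Theta d μ μ0 ∧ jgf d μ a ≤ 1}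

/-- Normal cone to a convex set `s ⊆ ℝ^d` at the point `a`. -/
noncomputable def normalCone (d : ℕ) (s : Set (Rd d)) (a : Rd d) : Set (Rd d) :=
  {q | ∀ b ∈ s, dotR d q (b - a) ≤ 0}

/-- The mean vector `m = ∑_z z μ(z)`. -/
noncomputable def meanVec (d : ℕ) (μ : Zd d → ℝ) : Rd d :=
  (fun i => ∑' z : Zd d, μ z * (z.1 i : ℝ), ∑' z : Zd d, μ z * (z.2 : ℝ))

/-- The harmonic functions `h_a` of (1-8), for `a ∈ D̂ ∩ ∂₊D` with associated
point `abar = ā ∈ ∂₋D` (same first `d-1` coordinates as `a`). -/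
noncomputable def hfun (d : ℕ) (μ μ0 : Zd d → ℝ) (a abar : Rd d) (z : St d) : ℝ :=
  if jgf d μ0 abar = 1 then Real.exp (dotZ d abar (toZ d z))
  else if a = abar then
    (z.2 : ℝ) * Real.exp (dotZ d a (toZ d z))
      + (jgfDβ d μ0 a / (1 - jgf d μ0 a)) * Real.exp (dotZ d a (toZ d z))
  else
    Real.exp (dotZ d a (toZ d z))
      - ((1 - jgf d μ0 a) / (1 - jgf d μ0 abar)) * Real.exp (dotZ d abar (toZ d z))

/-- `h : ℤ^{d-1}×ℕ → ℝ` is harmonic for the reflected walk. -/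
def IsHarmonic (d : ℕ) (μ μ0 : Zd d → ℝ) (h : St d → ℝ) : Prop :=
  ∀ z : St d, HasSum (fun z' => stepR d μ μ0 z z' * h z') (h z)

/-- Minimal nonnegative harmonic function. -/
def IsMinimalHarmonic (d : ℕ) (μ μ0 : Zd d → ℝ) (h : St d → ℝ) : Prop :=
  IsHarmonic d μ μ0 h ∧ (∀ z, 0 ≤ h z) ∧ h ≠ 0 ∧
    ∀ h' : St d → ℝ, IsHarmonic d μ μ0 h' → (∀ z, 0 ≤ h' z) → h' ≠ 0 →
      (∀ z, h' z ≤ h z) → ∃ c : ℝ, 0 < c ∧ h' = fun z => c * h z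

/- Hypotheses (H0)–(H4). -/

/-- `(H0)`: `μ(x,y) = 0` for `y < -1` and `μ₀(x,y) = 0` for `y < 0`. -/
def H0 (d : ℕ) (μ μ0 : Zd d → ℝ) : Prop :=
  (∀ z : Zd d, z.2 < -1 → μ z = 0) ∧ (∀ z : Zd d, z.2 < 0 → μ0 z = 0)

/-- `(H1)`: the reflected walk is irreducible on `ℤ^{d-1}×ℕ`. -/
def H1 (d : ℕ) (μ μ0 : Zd d → ℝ) : Prop :=
  ∀ z z' : St d, ∃ n : ℕ, 0 < stepn d μ μ0 n z z'

/-- `(H2)`: the homogeneous walk with step law `μ` is irreducible on `ℤ^d` and its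
last coordinate is an aperiodic random walk on `ℤ`. -/
def H2 (d : ℕ) (μ : Zd d → ℝ) : Prop :=
  (∀ z z' : Zd d, ∃ n : ℕ, 0 < stepSn d μ n z z') ∧
    AddSubgroup.closure {y : ℤ | ∃ x : Fin (d-1) → ℤ, μ (x, y) ≠ 0} = ⊤

/-- `(H3)`: `m ≠ 0` and `m/|m| + m₀/|m₀| ≠ 0`. -/
noncomputable def H3 (d : ℕ) (μ μ0 : Zd d → ℝ) : Prop :=
  meanVec d μ ≠ 0 ∧ meanVec d μ0 ≠ 0 ∧
    ‖meanVec d μ‖⁻¹ • meanVec d μ + ‖meanVec d μ0‖⁻¹ • meanVec d μ0 ≠ 0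

/-- `(H4)`: the jump generating functions are finite everywhere on `ℝ^d`. -/
def H4 (d : ℕ) (μ μ0 : Zd d → ℝ) : Prop :=
  ∀ a : Rd d, Summable (fun z : Zd d => μ z * Real.exp (dotZ d a z)) ∧
    Summable (fun z : Zd d => μ0 z * Real.exp (dotZ d a z))

/-- `μ` is a probability distribution on `ℤ^d`. -/
def IsProb (d : ℕ) (μ : Zd d → ℝ) : Prop :=
  (∀ z : Zd d, 0 ≤ μ z) ∧ HasSum μ 1


/-- The operator `f ↦ P f` associated with a kernel `P`. -/
noncomputable def kerOp {S : Type*} (p : S → S → ℝ≥0∞) (f : S → ℝ≥0∞) (z : S) : ℝ≥0∞ :=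
  ∑' w, p z w * f w

theorem tsum_kerIter_mul {S : Type*} [DecidableEq S] (p : S → S → ℝ≥0∞) (n : ℕ)
    (f : S → ℝ≥0∞) (z : S) : ∑' w, kerIter p n z w * f w = (kerOp p)^[n] f z := by
  induction n generalizing f with
  | zero =>
    rw [tsum_eq_single z]
    · simp [kerIter]
    · intro w hw
      simp [kerIter, Ne.symm hw]
  | succ n ih =>
    rw [Function.iterate_succ_apply, ← ih]
    simp only [kerIter, kerOp, ← ENNReal.tsum_mul_right, ← ENNReal.tsum_mul_left]
    rw [ENNReal.tsum_comm]
    simp only [mul_assoc]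

theorem kerIter_mono {S : Type*} [DecidableEq S] {p q : S → S → ℝ≥0∞}
    (h : ∀ z w, p z w ≤ q z w) (n : ℕ) (z w : S) : kerIter p n z w ≤ kerIter q n z w := by
  induction n generalizing w with
  | zero => exact le_rfl
  | succ n ih => exact ENNReal.tsum_le_tsum fun v => mul_le_mul' (ih v) (h v w)

/-- Along a path of positive probability a quantity that no single step decreases does not
decrease. -/
theorem le_of_kerIter_ne_zero {S : Type*} [DecidableEq S] {p : S → S → ℝ≥0∞} (f : S → ℤ)
    (h : ∀ z w, p z w ≠ 0 → f z ≤ f w) (n : ℕ) (z w : S) (hn : kerIter p n z w ≠ 0) :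
    f z ≤ f w := by
  induction n generalizing w with
  | zero =>
    by_cases hzw : z = w
    · rw [hzw]
    · simp [kerIter, hzw] at hn
  | succ n ih =>
    simp only [kerIter, ne_eq, ENNReal.tsum_eq_zero, not_forall, mul_eq_zero, not_or] at hn
    obtain ⟨v, hv, hvw⟩ := hn
    exact (ih v hv).trans (h v w hvw)

/-- The action of the exponentially tilted reflected walk on functions of the last coordinate;
`w` and `w0` are the tilted jump laws in the interior and on the boundary. -/
noncomputable def fiberOp (d : ℕ) (w w0 : Zd d → ℝ) (g : ℕ → ℝ≥0∞) (y : ℕ) : ℝ≥0∞ :=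
  ∑' z : Zd d, ENNReal.ofReal (if y = 0 then w0 z else w z) * g ((y : ℤ) + z.2).toNat

theorem dotZ_add (d : ℕ) (a : Rd d) (u v : Zd d) : dotZ d a (u + v) = dotZ d a u + dotZ d a v := by
  simp only [dotZ, Prod.fst_add, Prod.snd_add, Pi.add_apply, Int.cast_add, mul_add,
    Finset.sum_add_distrib]
  ring

theorem kerOp_step (d : ℕ) (μ μ0 : Zd d → ℝ) (hμ : ∀ z, 0 ≤ μ z) (hμ0 : ∀ z, 0 ≤ μ0 z)
    (hH0 : H0 d μ μ0) (a : Rd d) (g : ℕ → ℝ≥0∞) :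
    kerOp (step d μ μ0) (fun z => ENNReal.ofReal (Real.exp (dotZ d a (toZ d z))) * g z.2) =
      fun z => ENNReal.ofReal (Real.exp (dotZ d a (toZ d z))) *
        fiberOp d (fun v => μ v * Real.exp (dotZ d a v)) (fun v => μ0 v * Real.exp (dotZ d a v))
          g z.2 := by
  funext z
  have hinj : Function.Injective (fun w : St d => toZ d w - toZ d z) := by
    rintro ⟨x, y⟩ ⟨x', y'⟩ h
    simpa [toZ] using h
  rw [fiberOp, ← ENNReal.tsum_mul_left, kerOp, ← hinj.tsum_eq]
  · refine tsum_congr fun w => ?_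
    have hy : ((z.2 : ℤ) + (toZ d w - toZ d z).2).toNat = w.2 := by simp [toZ]
    have hexp : Real.exp (dotZ d a (toZ d w)) =
        Real.exp (dotZ d a (toZ d z)) * Real.exp (dotZ d a (toZ d w - toZ d z)) := by
      rw [← Real.exp_add, ← dotZ_add, add_sub_cancel]
    rw [hy, hexp, ENNReal.ofReal_mul (Real.exp_pos _).le, step]
    split_ifs
    · rw [ENNReal.ofReal_mul (hμ0 _)]
      ring
    · rw [ENNReal.ofReal_mul (hμ _)]
      ring
  · intro v hv
    have hnn : 0 ≤ (z.2 : ℤ) + v.2 := by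
      by_contra hneg
      apply hv
      by_cases hz : z.2 = 0
      · simp [hz, hH0.2 v (by omega)]
      · simp [hz, hH0.1 v (by omega)]
    refine ⟨(z.1 + v.1, ((z.2 : ℤ) + v.2).toNat), ?_⟩
    ext <;> simp [toZ, hnn]

theorem iterate_kerOp_step (d : ℕ) (μ μ0 : Zd d → ℝ) (hμ : ∀ z, 0 ≤ μ z) (hμ0 : ∀ z, 0 ≤ μ0 z)
    (hH0 : H0 d μ μ0) (a : Rd d) (g : ℕ → ℝ≥0∞) (n : ℕ) :
    (kerOp (step d μ μ0))^[n]
        (fun z => ENNReal.ofReal (Real.exp (dotZ d a (toZ d z))) * g z.2) =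
      fun z => ENNReal.ofReal (Real.exp (dotZ d a (toZ d z))) *
        (fiberOp d (fun v => μ v * Real.exp (dotZ d a v))
          (fun v => μ0 v * Real.exp (dotZ d a v)))^[n] g z.2 := by
  induction n generalizing g with
  | zero => rfl
  | succ n ih =>
    rw [Function.iterate_succ_apply, kerOp_step d μ μ0 hμ hμ0 hH0, ih, Function.iterate_succ_apply]

/-- Minimum principle for bounded functions that are harmonic, off the origin, for a
skip-free-to-the-left walk with nonpositive drift. -/
theorem le_of_harmonic_of_drift_nonpos {ι : Type*} (w : ι → ℝ) (k : ι → ℤ) (hw : ∀ i, 0 ≤ w i)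
    (hw1 : HasSum w 1) (hk : ∀ i, k i < -1 → w i = 0) (hdrift : Summable fun i => w i * (k i : ℝ))
    (hdrift' : ∑' i, w i * (k i : ℝ) ≤ 0) (i₀ : ι) (hi₀ : k i₀ = -1) (hwi₀ : 0 < w i₀)
    (v : ℕ → ℝ) (hv : ∀ y, 0 ≤ v y)
    (hharm : ∀ y : ℕ, 0 < y → HasSum (fun i => w i * v ((y : ℤ) + k i).toNat) (v y)) (y : ℕ) :
    v 0 ≤ v y := by
  have key : ∀ ε > 0, ∀ y : ℕ, v 0 ≤ v y + ε * y := by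
    intro ε hε
    have htend : Tendsto (fun y : ℕ => v y + ε * y) atTop atTop :=
      tendsto_atTop_mono (fun y => le_add_of_nonneg_left (hv y))
        (tendsto_natCast_atTop_atTop.const_mul_atTop hε)
    have hex : ∃ m : ℕ, ∀ y : ℕ, v m + ε * m ≤ v y + ε * y := by
      obtain ⟨N, hN⟩ := (htend.eventually_ge_atTop (v 0 + ε * (0 : ℕ))).exists_forall_of_atTop
      obtain ⟨m, -, hm⟩ := Finset.exists_min_image (Finset.range (N + 1))
        (fun y : ℕ => v y + ε * y) ⟨0, by simp⟩
      refine ⟨m, fun y => ?_⟩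
      rcases le_or_gt N y with h | h
      · exact (hm 0 (by simp)).trans (hN y h)
      · exact hm y (by simp; omega)
    classical
    have hmin := Nat.find_spec hex
    have hleast := fun n => Nat.find_min hex (m := n)
    set m := Nat.find hex
    rcases Nat.eq_zero_or_pos m with h0 | hpos
    · intro y
      simpa [h0] using hmin y
    · exfalso
      have hsum : HasSum (fun i => w i * (v ((m : ℤ) + k i).toNat + ε * (((m : ℤ) + k i).toNat : ℝ)
          - (v m + ε * m))) (ε * ∑' i, w i * (k i : ℝ)) := by
        have h1 := ((hharm m hpos).add (hdrift.hasSum.mul_left ε)).sub (hw1.mul_left (v m))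
        refine (congrArg₂ (HasSum · ·) (funext fun i => ?_) ?_).mp h1
        · symm
          by_cases hi : k i < -1
          · simp [hk i hi]
          · have : (((m : ℤ) + k i).toNat : ℝ) = (m : ℝ) + k i := by
              have h2 : ((((m : ℤ) + k i).toNat : ℤ) : ℝ) = (((m : ℤ) + k i : ℤ) : ℝ) := by
                rw [Int.toNat_of_nonneg (by omega)]
              push_cast at h2
              exact h2
            rw [this]
            ring
        · ring
      have hle := le_hasSum hsum i₀ fun i _ => mul_nonneg (hw i) (sub_nonneg.2 (hmin _))
      have hlt : v m + ε * m < v ((m : ℤ) + k i₀).toNat + ε * (((m : ℤ) + k i₀).toNat : ℝ) := by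
        have := hleast ((m : ℤ) + k i₀).toNat (by omega)
        push Not at this
        obtain ⟨y, hy⟩ := this
        exact (hmin y).trans_lt hy
      have := mul_pos hwi₀ (sub_pos.2 hlt)
      nlinarith
  refine le_of_forall_pos_le_add fun δ hδ => (key (δ / (y + 1)) (by positivity) y).trans ?_
  have : δ / (y + 1) * y ≤ δ := by
    rw [div_mul_eq_mul_div, div_le_iff₀ (by positivity)]
    nlinarith
  linarith

/-- Expected tilted number of visits to the origin, when the mass `c` of the tilted boundary law
is less than one. -/
theorem tsum_iterate_fiberOp (d : ℕ) (w w0 : Zd d → ℝ) (hw : ∀ z, 0 ≤ w z) (hw0 : ∀ z, 0 ≤ w0 z)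
    (hw1 : HasSum w 1) (c : ℝ) (hw01 : HasSum w0 c) (hc : c < 1)
    (hk : ∀ z : Zd d, z.2 < -1 → w z = 0) (hdrift : Summable fun z : Zd d => w z * (z.2 : ℝ))
    (hdrift' : ∑' z : Zd d, w z * (z.2 : ℝ) ≤ 0) (z₀ : Zd d) (hz₀ : z₀.2 = -1) (hwz₀ : 0 < w z₀)
    (y : ℕ) :
    ∑' n : ℕ, (fiberOp d w w0)^[n] (fun y => if y = 0 then 1 else 0) y =
      ENNReal.ofReal (1 - c)⁻¹ := by
  set e : ℕ → ℝ≥0∞ := fun y => if y = 0 then 1 else 0 with he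
  set F : ℕ → ℝ≥0∞ := fun y => ∑' n : ℕ, (fiberOp d w w0)^[n] e y with hF
  have hc0 : 0 ≤ c := hw01.nonneg hw0
  have hc1 : 0 < 1 - c := by linarith
  have hK : 0 < (1 - c)⁻¹ := inv_pos.2 hc1
  have hrow : ∀ y : ℕ, ∑' z : Zd d, ENNReal.ofReal (if y = 0 then w0 z else w z) =
      ENNReal.ofReal (if y = 0 then c else 1) := by
    intro y
    split_ifs
    · rw [← ENNReal.ofReal_tsum_of_nonneg hw0 hw01.summable, hw01.tsum_eq]
    · rw [← ENNReal.ofReal_tsum_of_nonneg hw hw1.summable, hw1.tsum_eq]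
  have hpart : ∀ N y, ∑ n ∈ Finset.range N, (fiberOp d w w0)^[n] e y ≤
      ENNReal.ofReal (1 - c)⁻¹ := by
    intro N
    induction N with
    | zero => simp
    | succ N ih =>
      intro y
      rw [Finset.sum_range_succ']
      have h1 : ∑ n ∈ Finset.range N, (fiberOp d w w0)^[n + 1] e y ≤
          ENNReal.ofReal ((if y = 0 then c else 1) * (1 - c)⁻¹) := by
        simp only [Function.iterate_succ_apply']
        simp only [fiberOp]
        rw [← Summable.tsum_finsetSum fun _ _ => ENNReal.summable]
        simp only [← Finset.mul_sum]
        refine (ENNReal.tsum_le_tsum fun z => mul_le_mul_right (ih _) _).trans ?_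
        rw [ENNReal.tsum_mul_right, hrow, ENNReal.ofReal_mul (by split_ifs <;> simp [hc0])]
      refine (add_le_add_left h1 _).trans ?_
      by_cases hy : y = 0
      · simp only [hy, if_true, Function.iterate_zero, id, he]
        rw [← ENNReal.ofReal_one, ← ENNReal.ofReal_add (by positivity) zero_le_one]
        apply ENNReal.ofReal_le_ofReal
        have := mul_inv_cancel₀ hc1.ne'
        linarith
      · simp [hy, he]
  have hFle : ∀ y, F y ≤ ENNReal.ofReal (1 - c)⁻¹ := fun y => by
    rw [hF]
    simp only
    rw [ENNReal.tsum_eq_iSup_nat]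
    exact iSup_le fun N => hpart N y
  have hFtop : ∀ y, F y ≠ ⊤ := fun y => ((hFle y).trans_lt ENNReal.ofReal_lt_top).ne
  have hFeq : ∀ y, F y = e y + fiberOp d w w0 F y := by
    intro y
    simp only [hF]
    rw [tsum_eq_zero_add' ENNReal.summable]
    congr 1
    simp only [Function.iterate_succ_apply']
    simp only [fiberOp, ← ENNReal.tsum_mul_left]
    rw [ENNReal.tsum_comm]
  have hsum : ∀ y : ℕ, HasSum (fun z : Zd d => (if y = 0 then w0 z else w z) *
      (F ((y : ℤ) + z.2).toNat).toReal) (fiberOp d w w0 F y).toReal := by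
    intro y
    have hne : fiberOp d w w0 F y ≠ ⊤ := fun h => hFtop y (by rw [hFeq, h, add_top])
    have hnn : ∀ z : Zd d, 0 ≤ if y = 0 then w0 z else w z := fun z => by
      split_ifs
      exacts [hw0 z, hw z]
    have h := ENNReal.hasSum_toReal hne
    rw [← ENNReal.tsum_toReal_eq (ENNReal.ne_top_of_tsum_ne_top hne)] at h
    rw [fiberOp]
    simpa only [ENNReal.toReal_mul, ENNReal.toReal_ofReal (hnn _)] using h
  have hmin : ∀ y, (F 0).toReal ≤ (F y).toReal := by
    refine le_of_harmonic_of_drift_nonpos w Prod.snd hw hw1 hk hdrift hdrift' z₀ hz₀ hwz₀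
      (fun y => (F y).toReal) (fun _ => ENNReal.toReal_nonneg) fun y hy => ?_
    have h := hsum y
    have h2 := hFeq y
    simp only [he, hy.ne', if_false, zero_add] at h h2
    rwa [← h2] at h
  have h0 : (F 0).toReal = 1 + (fiberOp d w w0 F 0).toReal := by
    have h2 := hFeq 0
    have hne : fiberOp d w w0 F 0 ≠ ⊤ := fun h => hFtop 0 (by rw [hFeq, h, add_top])
    rw [h2, ENNReal.toReal_add (by simp [he]) hne]
    simp [he]
  have h1 : c * (F 0).toReal ≤ (fiberOp d w w0 F 0).toReal := by
    have h := hsum 0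
    simp only [if_true] at h
    exact hasSum_le (fun z => mul_le_mul_of_nonneg_left (hmin _) (hw0 z))
      (hw01.mul_right _) h
  have h2 : (1 - c)⁻¹ ≤ (F 0).toReal := by
    rw [inv_eq_one_div, div_le_iff₀ hc1]
    linarith
  exact le_antisymm (hFle y) (ENNReal.ofReal_le_of_le_toReal (h2.trans (hmin y)))

/-- The weighted Green sum over the boundary in terms of the tilted walk's last coordinate. -/
theorem tsum_green_boundary (d : ℕ) (μ μ0 : Zd d → ℝ) (hμ : ∀ z, 0 ≤ μ z) (hμ0 : ∀ z, 0 ≤ μ0 z)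
    (hH0 : H0 d μ μ0) (a : Rd d) (z : St d) :
    ∑' x : Fin (d-1) → ℤ,
        green d μ μ0 z (x, 0) * ENNReal.ofReal (Real.exp (dotZ d a (toZ d (x, 0)))) =
      ENNReal.ofReal (Real.exp (dotZ d a (toZ d z))) *
        ∑' n : ℕ, (fiberOp d (fun v => μ v * Real.exp (dotZ d a v))
          (fun v => μ0 v * Real.exp (dotZ d a v)))^[n] (fun y => if y = 0 then 1 else 0) z.2 := by
  have hinj : Function.Injective (fun x : Fin (d-1) → ℤ => ((x, 0) : St d)) := fun x x' h => by
    simpa using h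
  have h1 := hinj.tsum_eq (f := fun w : St d => green d μ μ0 z w *
    (ENNReal.ofReal (Real.exp (dotZ d a (toZ d w))) * if w.2 = 0 then 1 else 0)) (by
      rintro ⟨x, y⟩ hv
      refine ⟨x, ?_⟩
      by_contra hy
      apply hv
      have : y ≠ 0 := fun h => hy (by simp [h])
      simp [this])
  simp only [if_true, mul_one] at h1
  rw [h1]
  simp only [green, ← ENNReal.tsum_mul_right]
  rw [ENNReal.tsum_comm, ← ENNReal.tsum_mul_left]
  refine tsum_congr fun n => ?_
  rw [stepn, tsum_kerIter_mul,
    iterate_kerOp_step d μ μ0 hμ hμ0 hH0 a (fun y => if y = 0 then 1 else 0)]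

theorem green_mono (d : ℕ) (μ : Zd d → ℝ) {μ0 μ0' : Zd d → ℝ} (h : ∀ z, μ0 z ≤ μ0' z)
    (z w : St d) : green d μ μ0 z w ≤ green d μ μ0' z w := by
  refine ENNReal.tsum_le_tsum fun n => kerIter_mono (fun u v => ?_) n z w
  simp only [step]
  split_ifs
  · exact ENNReal.ofReal_le_ofReal (h _)
  · exact le_rfl

theorem exists_pos_snd_eq_neg_one {d : ℕ} {μ μ0 : Zd d → ℝ} (hH0 : H0 d μ μ0) (hH2 : H2 d μ) :
    ∃ z : Zd d, z.2 = -1 ∧ 0 < μ z := by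
  by_contra hcon
  push Not at hcon
  obtain ⟨n, hn⟩ := hH2.1 0 (0, -1)
  have := le_of_kerIter_ne_zero (p := stepS d μ) Prod.snd (fun u v huv => by
    by_contra hlt
    apply huv
    have hlt' : (v - u).2 < 0 := by simpa using hlt
    rcases eq_or_ne (v - u).2 (-1) with h | h
    · simpa [stepS] using hcon _ h
    · simp [stepS, hH0.1 (v - u) (by omega)]) n 0 (0, -1) hn.ne'
  simp at this

theorem summable_mul_snd_mul_exp {d : ℕ} {μ : Zd d → ℝ} (hμ : ∀ z, 0 ≤ μ z)
    (hsum : ∀ a : Rd d, Summable fun z : Zd d => μ z * Real.exp (dotZ d a z)) (a : Rd d) :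
    Summable fun z : Zd d => μ z * Real.exp (dotZ d a z) * (z.2 : ℝ) := by
  refine Summable.of_norm_bounded ((hsum (a.1, a.2 + 1)).add (hsum (a.1, a.2 - 1))) fun z => ?_
  have h1 : dotZ d (a.1, a.2 + 1) z = dotZ d a z + z.2 := by
    simp only [dotZ]
    ring
  have h2 : dotZ d (a.1, a.2 - 1) z = dotZ d a z + -z.2 := by
    simp only [dotZ]
    ring
  have h3 : |(z.2 : ℝ)| ≤ Real.exp z.2 + Real.exp (-z.2) := by
    have := Real.add_one_le_exp (z.2 : ℝ)
    have := Real.add_one_le_exp (-(z.2 : ℝ))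
    have := Real.exp_pos (z.2 : ℝ)
    have := Real.exp_pos (-(z.2 : ℝ))
    rw [abs_le]
    constructor <;> linarith
  have h4 : 0 ≤ μ z * Real.exp (dotZ d a z) := mul_nonneg (hμ z) (Real.exp_pos _).le
  rw [h1, h2, Real.exp_add, Real.exp_add, norm_mul, Real.norm_of_nonneg h4, Real.norm_eq_abs]
  calc _ ≤ μ z * Real.exp (dotZ d a z) * (Real.exp z.2 + Real.exp (-z.2)) :=
        mul_le_mul_of_nonneg_left h3 h4
    _ = _ := by ring

/-- The boundary sum for a boundary law that need not be a probability, provided its tilted mass is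
less than one. -/
theorem tsum_green_boundary_of_lt_one {d : ℕ} {μ μ0 : Zd d → ℝ} (hμ : ∀ z, 0 ≤ μ z)
    (hμ0 : ∀ z, 0 ≤ μ0 z) (hH0 : H0 d μ μ0) (hH2 : H2 d μ)
    (hH4 : H4 d μ μ0) {a : Rd d} (ha : a ∈ bdMinus d μ) (hlt : jgf d μ0 a < 1) (z : St d) :
    ∑' x : Fin (d-1) → ℤ,
        green d μ μ0 z (x, 0) * ENNReal.ofReal (Real.exp (dotZ d a (toZ d (x, 0)))) =
      ENNReal.ofReal ((1 - jgf d μ0 a)⁻¹ * Real.exp (dotZ d a (toZ d z))) := by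
  obtain ⟨z₀, hz₀, hμz₀⟩ := exists_pos_snd_eq_neg_one hH0 hH2
  have hdrift : ∑' z : Zd d, μ z * Real.exp (dotZ d a z) * (z.2 : ℝ) ≤ 0 := by
    have := ha.2
    simpa only [jgfDβ, mul_right_comm] using this
  rw [tsum_green_boundary d μ μ0 hμ hμ0 hH0,
    tsum_iterate_fiberOp d _ _ (fun v => mul_nonneg (hμ v) (Real.exp_pos _).le)
      (fun v => mul_nonneg (hμ0 v) (Real.exp_pos _).le) (ha.1 ▸ (hH4 a).1.hasSum) (jgf d μ0 a)
      (hH4 a).2.hasSum hlt (fun v hv => by simp [hH0.1 v hv])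
      (summable_mul_snd_mul_exp hμ (fun b => (hH4 b).1) a) hdrift z₀ hz₀
      (mul_pos hμz₀ (Real.exp_pos _)),
    ← ENNReal.ofReal_mul (Real.exp_pos _).le, mul_comm]

/-- `∑_{w ∈ ℤ^{d-1}×{0}} G(z,w) e^{a·w}` equals
`(1-φ₀(ā))⁻¹ e^{ā·z}` when `φ₀(ā) < 1` and `+∞` when `φ₀(ā) ≥ 1`. -/
theorem green_boundary_sum
    (d : ℕ) (hd : 2 ≤ d) (μ μ0 : Zd d → ℝ)
    (hμ : IsProb d μ) (hμ0 : IsProb d μ0)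
    (hH0 : H0 d μ μ0) (hH1 : H1 d μ μ0) (hH2 : H2 d μ)
    (hH3 : H3 d μ μ0) (hH4 : H4 d μ μ0)
    (a abar : Rd d) (ha : a ∈ Dset d μ)
    (habar : abar ∈ bdMinus d μ ∧ abar.1 = a.1) :
    ∀ z : St d,
      (jgf d μ0 abar < 1 →
        ∑' x : Fin (d-1) → ℤ,
            green d μ μ0 z (x, 0) *
              ENNReal.ofReal (Real.exp (dotZ d a (toZ d (x, 0))))
          = ENNReal.ofReal
              ((1 - jgf d μ0 abar)⁻¹ * Real.exp (dotZ d abar (toZ d z)))) ∧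
      (1 ≤ jgf d μ0 abar →
        ∑' x : Fin (d-1) → ℤ,
            green d μ μ0 z (x, 0) *
              ENNReal.ofReal (Real.exp (dotZ d a (toZ d (x, 0)))) = ⊤) := by
  intro z
  obtain ⟨hbd, hfst⟩ := habar
  have hdot : ∀ x : Fin (d-1) → ℤ, dotZ d a (toZ d (x, 0)) = dotZ d abar (toZ d (x, 0)) := by
    intro x
    simp [dotZ, toZ, hfst]
  simp only [hdot]
  refine ⟨fun hlt => tsum_green_boundary_of_lt_one hμ.1 hμ0.1 hH0 hH2 hH4 hbd hlt z, fun hge => ?_⟩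
  refine ENNReal.eq_top_of_forall_nnreal_le fun r => ?_
  set c := jgf d μ0 abar with hc
  set E := Real.exp (dotZ d abar (toZ d z)) with hE
  have hE0 : 0 < E := Real.exp_pos _
  have hr : (0 : ℝ) ≤ r := r.2
  have hc0 : 0 < c := by linarith
  -- thin the boundary law so that its tilted mass becomes `t < 1`
  obtain ⟨t, ht0, ht1, htr⟩ : ∃ t : ℝ, 0 ≤ t ∧ t < 1 ∧ (r : ℝ) ≤ (1 - t)⁻¹ * E := by
    refine ⟨r / (r + E), by positivity, (div_lt_one (by positivity)).2 (by linarith), ?_⟩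
    have : 1 - (r : ℝ) / (r + E) = E / (r + E) := by
      field_simp
      ring
    rw [this, inv_div, div_mul_cancel₀ _ hE0.ne']
    linarith
  have hs0 : 0 ≤ t / c := by positivity
  have hs1 : t / c ≤ 1 := (div_le_one hc0).2 (by linarith)
  have hjgf : jgf d (fun v => t / c * μ0 v) abar = t := by
    simp only [jgf, mul_assoc, tsum_mul_left]
    exact div_mul_cancel₀ t hc0.ne'
  have hthin := tsum_green_boundary_of_lt_one (μ0 := fun v => t / c * μ0 v) hμ.1
    (fun v => mul_nonneg hs0 (hμ0.1 v)) ⟨hH0.1, fun v hv => by simp [hH0.2 v hv]⟩ hH2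
    (fun b => ⟨(hH4 b).1, by simpa only [mul_assoc] using (hH4 b).2.mul_left (t / c)⟩) hbd
    (hjgf.trans_lt ht1) z
  rw [hjgf] at hthin
  calc (r : ℝ≥0∞) = ENNReal.ofReal r := by simp
    _ ≤ ENNReal.ofReal ((1 - t)⁻¹ * E) := ENNReal.ofReal_le_ofReal htr
    _ = _ := hthin.symm
    _ ≤ _ := ENNReal.tsum_le_tsum fun x => mul_le_mul_left
      (green_mono d μ (fun v => mul_le_of_le_one_left (hμ0.1 v) hs1) z (x, 0)) _

end ReflectedRW
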